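/- Let λ > 0, φ, ψ ∈ (0, π), x ∈ ℝ, and ρ ∈ ℂ with |ρ|(sin φ + |sin(ψ−φ)|) < sin ψ. Then (1−e^{iφ}ρ)^{−λ+ix}(1−e^{−iφ}ρ)^{−λ−ix} = (1 − ρ sin(ψ−φ)/sin ψ)^{−2λ} Σ_{k=0}^∞ P_k^{(λ)}(x; ψ) ρ̃^k, where ρ̃ = ρ sin φ/(sin ψ − ρ sin(ψ−φ)) and the series converges absolutely. -/

import Mathlib

open Complex Finset

/-- The Pochhammer symbol (rising factorial) `(z)_n = z(z+1)⋯(z+n-1)`. -/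
noncomputable def poch (z : ℂ) (n : ℕ) : ℂ := ∏ i ∈ Finset.range n, (z + i)

/-- The Meixner–Pollaczek polynomial `P_n^{(λ)}(x; φ)` via its terminating
`₂F₁(-n, λ+ix; 2λ; 1-e^{-2iφ})` representation. -/
noncomputable def MP (n : ℕ) (lam : ℝ) (x : ℝ) (phi : ℝ) : ℂ :=
  poch ((2 * lam : ℝ) : ℂ) n / (n.factorial : ℂ) * Complex.exp (Complex.I * n * phi) *
    ∑ k ∈ Finset.range (n + 1),
      poch (-(n : ℂ)) k * poch ((lam : ℂ) + Complex.I * x) k /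
          (poch ((2 * lam : ℝ) : ℂ) k * k.factorial) *
        (1 - Complex.exp (-2 * Complex.I * phi)) ^ k

/-- The coefficients of the binomial series of `(1 - w) ^ (-a)`. -/
noncomputable def risingBinom (a : ℂ) (n : ℕ) : ℂ := poch a n / n.factorial

lemma poch_zero (a : ℂ) : poch a 0 = 1 := by simp [poch]

lemma poch_succ (a : ℂ) (n : ℕ) : poch a (n + 1) = poch a n * (a + n) := by
  simp [poch, Finset.prod_range_succ]

lemma poch_add (a : ℂ) (k d : ℕ) : poch a (k + d) = poch a k * poch (a + k) d := by
  simp [poch, Finset.prod_range_add, add_assoc]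

lemma poch_ne_zero {c : ℝ} (hc : 0 < c) (k : ℕ) : poch (c : ℂ) k ≠ 0 := by
  refine Finset.prod_ne_zero_iff.mpr fun i _ => ?_
  norm_cast
  positivity

lemma poch_neg_natCast (d k : ℕ) :
    poch (-((k + d : ℕ) : ℂ)) k = (-1) ^ k * ((k + d).factorial / d.factorial) := by
  induction k generalizing d with
  | zero => simp [poch_zero, div_self, Nat.factorial_ne_zero]
  | succ k ih =>
    have h := ih (d + 1)
    rw [show k + (d + 1) = k + 1 + d by ring] at h
    rw [poch_succ, h, Nat.factorial_succ d]
    have h1 : (d.factorial : ℂ) ≠ 0 := by exact_mod_cast d.factorial_ne_zero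
    have h2 : (d : ℂ) + 1 ≠ 0 := by exact_mod_cast d.succ_ne_zero
    push_cast
    field_simp
    ring

lemma risingBinom_eq_choose (a : ℂ) (n : ℕ) :
    risingBinom a n = Ring.choose (a + n - 1) n := by
  have h : poch a n = (ascPochhammer ℕ n).smeval a := by
    induction n with
    | zero => simp [poch_zero]
    | succ n ih =>
      rw [poch_succ, ih, ascPochhammer_succ_right, Polynomial.smeval_mul]
      simp [Polynomial.smeval_add, Polynomial.smeval_natCast]
  have h1 : (n.factorial : ℂ) ≠ 0 := by exact_mod_cast n.factorial_ne_zero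
  rw [risingBinom, div_eq_iff h1, h, ← Ring.factorial_nsmul_multichoose_eq_ascPochhammer,
    Ring.multichoose_eq, nsmul_eq_mul, mul_comm]

lemma risingBinom_eq_choose_neg (a : ℂ) (n : ℕ) :
    risingBinom a n = (-1) ^ n * Ring.choose (-a) n := by
  rw [risingBinom_eq_choose, Ring.choose_neg, Units.smul_def]
  simp [← mul_assoc, ← mul_pow]

/-- The Chu–Vandermonde identity. -/
lemma risingBinom_add (a b : ℂ) (n : ℕ) :
    risingBinom (a + b) n =
      ∑ i ∈ Finset.range (n + 1), risingBinom a i * risingBinom b (n - i) := by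
  rw [risingBinom_eq_choose_neg, neg_add, Ring.add_choose_eq n (Commute.all _ _), Finset.mul_sum,
    Finset.Nat.sum_antidiagonal_eq_sum_range_succ
      (fun i j => (-1) ^ n * (Ring.choose (-a) i * Ring.choose (-b) j))]
  refine Finset.sum_congr rfl fun i hi => ?_
  have hi' : i + (n - i) = n := by grind
  rw [risingBinom_eq_choose_neg, risingBinom_eq_choose_neg]
  nth_rewrite 1 [← hi']
  ring

lemma risingBinom_mul_risingBinom (a : ℂ) (k i : ℕ) :
    risingBinom a k * risingBinom (a + k) i = (k + i).choose k * risingBinom a (k + i) := by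
  have h := Nat.add_choose_mul_factorial_mul_factorial k i
  have h1 : (k.factorial : ℂ) ≠ 0 := by exact_mod_cast k.factorial_ne_zero
  have h2 : (i.factorial : ℂ) ≠ 0 := by exact_mod_cast i.factorial_ne_zero
  have h3 : ((k + i).factorial : ℂ) ≠ 0 := by exact_mod_cast (k + i).factorial_ne_zero
  rw [risingBinom, risingBinom, risingBinom, poch_add]
  field_simp
  rw [← h, Nat.choose_symm_add]
  push_cast
  ring

lemma risingBinom_mul_risingBinom_add (a b : ℂ) {n k : ℕ} (hk : k ≤ n) :
    risingBinom a k * risingBinom (a + b + k) (n - k) =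
      ∑ m ∈ Finset.range (n + 1), m.choose k * (risingBinom a m * risingBinom b (n - m)) := by
  obtain ⟨d, rfl⟩ := Nat.exists_eq_add_of_le hk
  rw [add_assoc k d 1, Finset.sum_range_add, Finset.sum_eq_zero, zero_add, add_right_comm a b,
    Nat.add_sub_cancel_left, risingBinom_add, Finset.mul_sum]
  · refine Finset.sum_congr rfl fun i _ => ?_
    rw [← mul_assoc, risingBinom_mul_risingBinom, Nat.add_sub_add_left, mul_assoc]
  · intro m hm
    simp [Nat.choose_eq_zero_of_lt (Finset.mem_range.mp hm)]

/-- A terminating hypergeometric sum as a convolution of binomial coefficients. -/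
lemma sum_poch_eq_sum_risingBinom (a b z : ℂ) (n : ℕ) (hc : ∀ k, poch (a + b) k ≠ 0) :
    poch (a + b) n / n.factorial *
        ∑ k ∈ Finset.range (n + 1),
          poch (-(n : ℂ)) k * poch a k / (poch (a + b) k * k.factorial) * (1 - z) ^ k =
      ∑ m ∈ Finset.range (n + 1), risingBinom a m * risingBinom b (n - m) * z ^ m := by
  have key : ∀ k ∈ Finset.range (n + 1), poch (a + b) n / n.factorial *
      (poch (-(n : ℂ)) k * poch a k / (poch (a + b) k * k.factorial) * (1 - z) ^ k) =
      ∑ m ∈ Finset.range (n + 1),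
        risingBinom a m * risingBinom b (n - m) * ((z - 1) ^ k * m.choose k) := by
    intro k hk
    have hk' : k ≤ n := by grind
    have h := risingBinom_mul_risingBinom_add a b hk'
    have h' : poch (a + b) n / n.factorial *
      (poch (-(n : ℂ)) k * poch a k / (poch (a + b) k * k.factorial) * (1 - z) ^ k) =
        (z - 1) ^ k * (risingBinom a k * risingBinom (a + b + k) (n - k)) := by
      obtain ⟨d, rfl⟩ := Nat.exists_eq_add_of_le hk'
      have h1 : (k.factorial : ℂ) ≠ 0 := by exact_mod_cast k.factorial_ne_zero
      have h2 : (d.factorial : ℂ) ≠ 0 := by exact_mod_cast d.factorial_ne_zero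
      have h3 : ((k + d).factorial : ℂ) ≠ 0 := by exact_mod_cast (k + d).factorial_ne_zero
      rw [poch_neg_natCast, poch_add, risingBinom, risingBinom, Nat.add_sub_cancel_left,
        ← neg_sub 1 z, neg_pow (1 - z)]
      field_simp [hc k]
    rw [h', h, Finset.mul_sum]
    exact Finset.sum_congr rfl fun m _ => by ring
  rw [Finset.mul_sum, Finset.sum_congr rfl key, Finset.sum_comm]
  refine Finset.sum_congr rfl fun m hm => ?_
  rw [← Finset.mul_sum]
  congr 1
  have hz := add_pow (z - 1) 1 m
  simp only [one_pow, mul_one, sub_add_cancel] at hz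
  rw [hz]
  refine (Finset.sum_subset (by grind) fun k _ hk => ?_).symm
  rw [Nat.choose_eq_zero_of_lt (by grind)]
  simp

lemma MP_eq_sum_risingBinom (n : ℕ) {lam : ℝ} (hlam : 0 < lam) (x phi : ℝ) :
    MP n lam x phi = ∑ m ∈ Finset.range (n + 1),
      risingBinom (lam + Complex.I * x) m * Complex.exp (-Complex.I * phi) ^ m *
        (risingBinom (lam - Complex.I * x) (n - m) * Complex.exp (Complex.I * phi) ^ (n - m)) := by
  have hc : ((2 * lam : ℝ) : ℂ) = (lam + Complex.I * x) + (lam - Complex.I * x) := by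
    push_cast; ring
  have hne : ∀ k, poch ((lam + Complex.I * x) + (lam - Complex.I * x)) k ≠ 0 := by
    rw [← hc]; exact poch_ne_zero (by positivity)
  rw [MP, hc, mul_right_comm, sum_poch_eq_sum_risingBinom _ _ _ n hne, Finset.sum_mul]
  refine Finset.sum_congr rfl fun m hm => ?_
  have hm' : m ≤ n := by grind
  have he : Complex.exp (-2 * Complex.I * phi) ^ m * Complex.exp (Complex.I * n * phi) =
      Complex.exp (-Complex.I * phi) ^ m * Complex.exp (Complex.I * phi) ^ (n - m) := by
    rw [← Complex.exp_nat_mul, ← Complex.exp_nat_mul, ← Complex.exp_nat_mul, ← Complex.exp_add,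
      ← Complex.exp_add, Nat.cast_sub hm']
    congr 1
    ring
  rw [mul_assoc, he]
  ring

/-- The binomial series converges absolutely to a complex power. -/
lemma hasSum_risingBinom (a : ℂ) {w : ℂ} (hw : ‖w‖ < 1) :
    HasSum (fun n => risingBinom a n * w ^ n) ((1 - w) ^ (-a)) ∧
      Summable fun n => ‖risingBinom a n * w ^ n‖ := by
  have h := Complex.one_div_one_sub_cpow_hasFPowerSeriesOnBall_zero a
  have hw' : w ∈ Metric.eball (0 : ℂ) 1 := by
    simpa [Metric.mem_eball, edist_zero_right, enorm_eq_nnnorm, ← NNReal.coe_lt_coe] using hw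
  constructor
  · simpa [FormalMultilinearSeries.ofScalars_apply_eq, ← risingBinom_eq_choose, Complex.cpow_neg,
      mul_comm] using h.hasSum hw'
  · have := FormalMultilinearSeries.summable_norm_apply _
      (Metric.eball_subset_eball h.r_le hw')
    simpa [FormalMultilinearSeries.ofScalars_apply_eq, ← risingBinom_eq_choose, mul_comm]
      using this

/-- The classical generating function of the Meixner–Pollaczek polynomials. -/
lemma MP_generating_function {lam : ℝ} (hlam : 0 < lam) (x phi : ℝ) {w : ℂ} (hw : ‖w‖ < 1) :
    Summable (fun k : ℕ => ‖MP k lam x phi * w ^ k‖) ∧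
      ∑' k : ℕ, MP k lam x phi * w ^ k =
        (1 - Complex.exp (-Complex.I * phi) * w) ^ (-(lam + Complex.I * x)) *
          (1 - Complex.exp (Complex.I * phi) * w) ^ (-(lam - Complex.I * x)) := by
  have h1 : ‖Complex.exp (-Complex.I * phi) * w‖ < 1 := by
    simpa [norm_mul, Complex.norm_exp] using hw
  have h2 : ‖Complex.exp (Complex.I * phi) * w‖ < 1 := by
    simpa [norm_mul, Complex.norm_exp] using hw
  obtain ⟨s1, n1⟩ := hasSum_risingBinom (lam + Complex.I * x) h1
  obtain ⟨s2, n2⟩ := hasSum_risingBinom (lam - Complex.I * x) h2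
  have hterm : (fun k : ℕ => MP k lam x phi * w ^ k) = fun n => ∑ p ∈ Finset.HasAntidiagonal.antidiagonal n,
      risingBinom (lam + Complex.I * x) p.1 * (Complex.exp (-Complex.I * phi) * w) ^ p.1 *
        (risingBinom (lam - Complex.I * x) p.2 * (Complex.exp (Complex.I * phi) * w) ^ p.2) := by
    ext n
    rw [MP_eq_sum_risingBinom n hlam, Finset.sum_mul,
      Finset.Nat.sum_antidiagonal_eq_sum_range_succ (fun i j =>
        risingBinom (lam + Complex.I * x) i * (Complex.exp (-Complex.I * phi) * w) ^ i *
          (risingBinom (lam - Complex.I * x) j * (Complex.exp (Complex.I * phi) * w) ^ j))]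
    refine Finset.sum_congr rfl fun m hm => ?_
    have hw : w ^ n = w ^ m * w ^ (n - m) := by rw [← pow_add]; congr 1; grind
    rw [hw, mul_pow, mul_pow]
    ring
  constructor
  · simpa only [funext_iff.mp hterm] using
      summable_norm_sum_mul_antidiagonal_of_summable_norm n1 n2
  · rw [hterm, ← tsum_mul_tsum_eq_tsum_sum_antidiagonal_of_summable_norm n1 n2, s1.tsum_eq,
      s2.tsum_eq]

lemma mul_cpow_of_re_pos {z w : ℂ} (hz : 0 < z.re) (hw : 0 < w.re) (s : ℂ) :
    (z * w) ^ s = z ^ s * w ^ s := by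
  have hz0 : z ≠ 0 := by rintro rfl; simp at hz
  have hw0 : w ≠ 0 := by rintro rfl; simp at hw
  have h1 := abs_lt.mp (Complex.abs_arg_lt_pi_div_two_iff.mpr (Or.inl hz))
  have h2 := abs_lt.mp (Complex.abs_arg_lt_pi_div_two_iff.mpr (Or.inl hw))
  rw [Complex.cpow_def_of_ne_zero (mul_ne_zero hz0 hw0), Complex.cpow_def_of_ne_zero hz0,
    Complex.cpow_def_of_ne_zero hw0,
    (Complex.log_mul_eq_add_log_iff hz0 hw0).mpr ⟨by linarith, by linarith⟩, add_mul,
    Complex.exp_add]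

lemma re_one_sub_pos {w : ℂ} (hw : ‖w‖ < 1) : 0 < (1 - w).re := by
  have := Complex.re_le_norm w
  simp only [Complex.sub_re, Complex.one_re]
  linarith

lemma sin_sub_add_exp_mul_sin (phi psi : ℂ) :
    Complex.sin (psi - phi) + Complex.exp (Complex.I * psi) * Complex.sin phi =
      Complex.sin psi * Complex.exp (Complex.I * phi) := by
  rw [mul_comm Complex.I, mul_comm Complex.I, Complex.exp_mul_I, Complex.exp_mul_I,
    Complex.sin_sub]
  ring

theorem MP_generalized_generating_function (lam : ℝ) (hlam : 0 < lam) (phi psi : ℝ)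
    (hphi : phi ∈ Set.Ioo 0 Real.pi) (hpsi : psi ∈ Set.Ioo 0 Real.pi)
    (x : ℝ) (ρ : ℂ)
    (hρ : ‖ρ‖ * (Real.sin phi + |Real.sin (psi - phi)|) < Real.sin psi) :
    Summable (fun k : ℕ => ‖MP k lam x psi *
        (ρ * Real.sin phi / ((Real.sin psi : ℂ) - ρ * Real.sin (psi - phi))) ^ k‖) ∧
      (1 - Complex.exp (Complex.I * phi) * ρ) ^ (-(lam : ℂ) + Complex.I * x) *
          (1 - Complex.exp (-Complex.I * phi) * ρ) ^ (-(lam : ℂ) - Complex.I * x) =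
        (1 - ρ * Real.sin (psi - phi) / Real.sin psi) ^ (-(2 * lam : ℝ) : ℂ) *
          ∑' k : ℕ, MP k lam x psi *
            (ρ * Real.sin phi / ((Real.sin psi : ℂ) - ρ * Real.sin (psi - phi))) ^ k := by
  have hs : 0 < Real.sin psi := Real.sin_pos_of_mem_Ioo hpsi
  have hp : 0 < Real.sin phi := Real.sin_pos_of_mem_Ioo hphi
  have hsC : (Real.sin psi : ℂ) ≠ 0 := by exact_mod_cast hs.ne'
  rw [mul_add] at hρ
  have hnum : ‖ρ * (Real.sin phi : ℂ)‖ = ‖ρ‖ * Real.sin phi := by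
    rw [norm_mul, Complex.norm_real, Real.norm_of_nonneg hp.le]
  have hden : ‖ρ * (Real.sin (psi - phi) : ℂ)‖ = ‖ρ‖ * |Real.sin (psi - phi)| := by
    rw [norm_mul, Complex.norm_real, Real.norm_eq_abs]
  have hnn : 0 ≤ ‖ρ‖ * Real.sin phi := by positivity
  have hlow : Real.sin psi - ‖ρ‖ * |Real.sin (psi - phi)| ≤
      ‖(Real.sin psi : ℂ) - ρ * Real.sin (psi - phi)‖ := by
    have := norm_sub_norm_le (Real.sin psi : ℂ) (ρ * Real.sin (psi - phi))
    rwa [hden, Complex.norm_real, Real.norm_of_nonneg hs.le] at this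
  have hpos : 0 < ‖(Real.sin psi : ℂ) - ρ * Real.sin (psi - phi)‖ := by linarith
  have hE : (Real.sin psi : ℂ) - ρ * Real.sin (psi - phi) ≠ 0 := norm_pos_iff.mp hpos
  set w : ℂ := ρ * Real.sin phi / ((Real.sin psi : ℂ) - ρ * Real.sin (psi - phi)) with hw_def
  have hw : ‖w‖ < 1 := by
    rw [hw_def, norm_div, div_lt_one hpos, hnum]
    linarith
  set D : ℂ := 1 - ρ * Real.sin (psi - phi) / Real.sin psi with hD_def
  have hD : 0 < D.re := by
    refine re_one_sub_pos ?_
    rw [norm_div, hden, Complex.norm_real, Real.norm_of_nonneg hs.le, div_lt_one hs]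
    linarith
  have hD0 : D ≠ 0 := by rintro h; simp [h] at hD
  have factor : ∀ e f : ℂ,
      (Real.sin (psi - phi) : ℂ) + e * Real.sin phi = Real.sin psi * f →
      1 - f * ρ = D * (1 - e * w) := by
    intro e f h
    have hDE : D = ((Real.sin psi : ℂ) - ρ * Real.sin (psi - phi)) / Real.sin psi := by
      rw [hD_def]; field_simp
    rw [hDE, hw_def]
    field_simp
    linear_combination ρ * h
  have hf1 : 1 - Complex.exp (Complex.I * phi) * ρ =
      D * (1 - Complex.exp (Complex.I * psi) * w) := by
    refine factor _ _ ?_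
    push_cast
    exact sin_sub_add_exp_mul_sin _ _
  have hf2 : 1 - Complex.exp (-Complex.I * phi) * ρ =
      D * (1 - Complex.exp (-Complex.I * psi) * w) := by
    refine factor _ _ ?_
    have h := sin_sub_add_exp_mul_sin (-(phi : ℂ)) (-psi)
    rw [show -(psi : ℂ) - -phi = -(psi - phi) by ring, Complex.sin_neg, Complex.sin_neg,
      Complex.sin_neg, mul_neg Complex.I, mul_neg Complex.I] at h
    push_cast
    rw [neg_mul, neg_mul]
    linear_combination -h
  have hr1 : 0 < (1 - Complex.exp (Complex.I * psi) * w).re :=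
    re_one_sub_pos (by simpa [norm_mul, Complex.norm_exp] using hw)
  have hr2 : 0 < (1 - Complex.exp (-Complex.I * psi) * w).re :=
    re_one_sub_pos (by simpa [norm_mul, Complex.norm_exp] using hw)
  obtain ⟨hsum, htsum⟩ := MP_generating_function hlam x psi hw
  refine ⟨hsum, ?_⟩
  have hDpow : D ^ (-(2 * lam : ℝ) : ℂ) =
      D ^ (-(lam : ℂ) + Complex.I * x) * D ^ (-(lam : ℂ) - Complex.I * x) := by
    rw [← Complex.cpow_add _ _ hD0]
    congr 1
    push_cast
    ring
  rw [htsum, hf1, hf2, mul_cpow_of_re_pos hD hr1, mul_cpow_of_re_pos hD hr2, hDpow,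
    show -(lam + Complex.I * x) = -(lam : ℂ) - Complex.I * x by ring,
    show -(lam - Complex.I * x) = -(lam : ℂ) + Complex.I * x by ring]
  ring
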